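/- Let T₁ and T₂ be full binary trees (ordered rooted binary trees in which every internal node has exactly two children) with the same number of leaves, and suppose S is a subtree that occurs in both T₁ and T₂ spanning the same interval of leaf positions. Let T₁' and T₂' be the trees obtained from T₁ and T₂ respectively by replacing S with a single new leaf (the subtree reduction rule). Then the rotation distance is preserved: d_R(T₁', T₂') = d_R(T₁, T₂). -/

import Mathlib

/-- Full binary trees: ordered rooted trees in which every internal node has
exactly two children.  A `leaf` has one leaf; `node l r` has the leaves of `l`
followed by the leaves of `r` in left-to-right order. -/
inductive BT : Type
  | leaf : BT
  | node : BT → BT → BT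
deriving DecidableEq

namespace BT

/-- The number of leaves (the size) of a full binary tree. -/
def numLeaves : BT → ℕ
  | leaf => 1
  | node l r => numLeaves l + numLeaves r

/-- A single rotation (left or right) performed at some node of the tree.
A right rotation replaces a subtree `(A ∧ B) ∧ C` by `A ∧ (B ∧ C)`; a left
rotation is the inverse.  The left-to-right order of leaves is unchanged. -/
inductive Rot : BT → BT → Prop
  | rotR (a b c : BT) : Rot (node (node a b) c) (node a (node b c))
  | rotL (a b c : BT) : Rot (node a (node b c)) (node (node a b) c)
  | congL {l l' : BT} (r : BT) : Rot l l' → Rot (node l r) (node l' r)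
  | congR (l : BT) {r r' : BT} : Rot r r' → Rot (node l r) (node l r')

/-- `RotSeq n t u` : there is a sequence of exactly `n` rotations
transforming `t` into `u`. -/
inductive RotSeq : ℕ → BT → BT → Prop
  | refl (t : BT) : RotSeq 0 t t
  | step {n : ℕ} {t u v : BT} : Rot t u → RotSeq n u v → RotSeq (n + 1) t v

/-- The rotation distance between two trees: the least number of rotations
needed to transform one into the other. -/
noncomputable def rotDist (t u : BT) : ℕ := sInf {n | RotSeq n t u}

/-- `OccursAt S T p` : the subtree of `T` at the path `p` (a list of
directions, `false` = left child, `true` = right child) is exactly `S`. -/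
inductive OccursAt : BT → BT → List Bool → Prop
  | here (T : BT) : OccursAt T T []
  | left {S l : BT} {p : List Bool} (r : BT) :
      OccursAt S l p → OccursAt S (node l r) (false :: p)
  | right (l : BT) {S r : BT} {p : List Bool} :
      OccursAt S r p → OccursAt S (node l r) (true :: p)

/-- Replace the subtree at path `p` of `T` by `R`. -/
def replaceAt : BT → List Bool → BT → BT
  | _, [], R => R
  | leaf, _ :: _, _ => leaf
  | node l r, false :: p, R => node (replaceAt l p R) r
  | node l r, true :: p, R => node l (replaceAt r p R)

/-- The number of leaves of `T` lying strictly to the left of the subtree at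
path `p`; together with the size of that subtree this determines the interval
of leaf positions it spans. -/
def leavesBefore : BT → List Bool → ℕ
  | _, [] => 0
  | leaf, _ :: _ => 0
  | node l _, false :: p => leavesBefore l p
  | node l r, true :: p => numLeaves l + leavesBefore r p

/-- Build a chain of pendant subtrees above the tree `rest`.  Each entry
`(b, t)` attaches the pendant subtree `t` as the left child of its parent when
`b = true` and as the right child when `b = false`; the parent of each pendant
subtree is the grandparent of the next one, and depths increase along the
list. -/
def buildChain : List (Bool × BT) → BT → BT
  | [], rest => rest
  | (true, t) :: L, rest => node t (buildChain L rest)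
  | (false, t) :: L, rest => node (buildChain L rest) t

/-- The number of leaves lying strictly to the left of the `j`-th pendant
subtree inside the chain `buildChain L rest` (relative to the root of the
chain). -/
def pendantOffset : List (Bool × BT) → BT → ℕ → ℕ
  | [], _, _ => 0
  | (b, _) :: L, rest, 0 => if b then 0 else numLeaves (buildChain L rest)
  | (b, t) :: L, rest, j + 1 =>
      (if b then numLeaves t else 0) + pendantOffset L rest j

/-- `IsCommonChain T₁ T₂ p₁ p₂ bs ts R₁ R₂` : the pendant subtrees `ts` form a
common chain of `T₁` and `T₂`, rooted at path `p₁` in `T₁` (with the `j`-th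
pendant subtree a left child of its parent iff `bs j = true`) and at path `p₂`
in `T₂` (with all the sides reversed), with the trees `R₁`, `R₂` hanging below
the chain, and with each pendant subtree occupying the same interval of leaf
positions in `T₁` and in `T₂`. -/
def IsCommonChain (T₁ T₂ : BT) (p₁ p₂ : List Bool) (bs : List Bool)
    (ts : List BT) (R₁ R₂ : BT) : Prop :=
  bs.length = ts.length ∧
  OccursAt (buildChain (bs.zip ts) R₁) T₁ p₁ ∧
  OccursAt (buildChain ((bs.map fun b => !b).zip ts) R₂) T₂ p₂ ∧
  ∀ j < ts.length,
    leavesBefore T₁ p₁ + pendantOffset (bs.zip ts) R₁ j =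
      leavesBefore T₂ p₂ + pendantOffset ((bs.map fun b => !b).zip ts) R₂ j

/-- One application of the subtree reduction rule to a pair of trees: a common
subtree `S` with at least two leaves, occurring at the same leaf positions in
both trees, is replaced in each tree by a single placeholder leaf. -/
def SubtreeStep (P Q : BT × BT) : Prop :=
  ∃ (S : BT) (p₁ p₂ : List Bool),
    2 ≤ numLeaves S ∧
    OccursAt S P.1 p₁ ∧ OccursAt S P.2 p₂ ∧
    leavesBefore P.1 p₁ = leavesBefore P.2 p₂ ∧
    Q.1 = replaceAt P.1 p₁ leaf ∧ Q.2 = replaceAt P.2 p₂ leaf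

/-- One application of the common chain reduction rule to a pair of trees: a
common chain of more than three pendant subtrees is replaced in both trees by
a common chain of three pendant leaves, ordered the same way in both trees. -/
def ChainStep (P Q : BT × BT) : Prop :=
  ∃ (p₁ p₂ bs cs : List Bool) (ts : List BT) (R₁ R₂ : BT),
    4 ≤ ts.length ∧ cs.length = 3 ∧
    IsCommonChain P.1 P.2 p₁ p₂ bs ts R₁ R₂ ∧
    Q.1 = replaceAt P.1 p₁ (buildChain (cs.zip [leaf, leaf, leaf]) R₁) ∧
    Q.2 = replaceAt P.2 p₂
      (buildChain ((cs.map fun b => !b).zip [leaf, leaf, leaf]) R₂) ∧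
    IsCommonChain Q.1 Q.2 p₁ p₂ cs [leaf, leaf, leaf] R₁ R₂

/-- One application of either reduction rule. -/
def RedStep (P Q : BT × BT) : Prop := SubtreeStep P Q ∨ ChainStep P Q

/-- A pair of trees is fully reduced when neither reduction rule applies. -/
def Reduced (P : BT × BT) : Prop := ∀ Q, ¬ RedStep P Q

/-- `ExhaustiveReduction P Q` : the pair `Q` is obtained from the pair `P` by
applying the subtree reduction rule and the common chain reduction rule
exhaustively, i.e. repeatedly until neither rule applies. -/
def ExhaustiveReduction (P Q : BT × BT) : Prop :=
  Relation.ReflTransGen RedStep P Q ∧ Reduced Q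

end BT

namespace BT

lemma numLeaves_pos (t : BT) : 0 < numLeaves t := by
  induction t with
  | leaf => simp [numLeaves]
  | node l r _ _ => simp only [numLeaves]; omega

lemma Rot.numLeaves_eq {t u : BT} (h : Rot t u) : numLeaves t = numLeaves u := by
  induction h <;> simp only [numLeaves] <;> omega

lemma OccursAt.leavesBefore_add_le {S T : BT} {p : List Bool} (h : OccursAt S T p) :
    leavesBefore T p + numLeaves S ≤ numLeaves T := by
  induction h <;> simp only [numLeaves, leavesBefore] <;> omega

/-- Replace the leaf number `k` (counted from `0`) by the tree `S`. -/
def graft (S : BT) : BT → ℕ → BT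
  | leaf, _ => S
  | node l r, k =>
      if k < numLeaves l then node (graft S l k) r
      else node l (graft S r (k - numLeaves l))

lemma Rot.graft (S : BT) {t u : BT} (h : Rot t u) (k : ℕ) :
    Rot (graft S t k) (graft S u k) := by
  induction h generalizing k with
  | rotR a b c =>
    by_cases h₁ : k < numLeaves a
    · have h₂ : k < numLeaves a + numLeaves b := by omega
      simpa [BT.graft, numLeaves, h₁, h₂] using Rot.rotR _ _ _
    · by_cases h₂ : k < numLeaves a + numLeaves b
      · have h₃ : k - numLeaves a < numLeaves b := by omega
        simpa [BT.graft, numLeaves, h₁, h₂, h₃] using Rot.rotR _ _ _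
      · have h₃ : ¬ k - numLeaves a < numLeaves b := by omega
        simpa [BT.graft, numLeaves, h₁, h₂, h₃, Nat.sub_sub] using Rot.rotR _ _ _
  | rotL a b c =>
    by_cases h₁ : k < numLeaves a
    · have h₂ : k < numLeaves a + numLeaves b := by omega
      simpa [BT.graft, numLeaves, h₁, h₂] using Rot.rotL _ _ _
    · by_cases h₂ : k < numLeaves a + numLeaves b
      · have h₃ : k - numLeaves a < numLeaves b := by omega
        simpa [BT.graft, numLeaves, h₁, h₂, h₃] using Rot.rotL _ _ _
      · have h₃ : ¬ k - numLeaves a < numLeaves b := by omega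
        simpa [BT.graft, numLeaves, h₁, h₂, h₃, Nat.sub_sub] using Rot.rotL _ _ _
  | congL r h ih =>
    simp only [BT.graft, h.numLeaves_eq]
    split
    · exact Rot.congL _ (ih k)
    · exact Rot.congL _ h
  | congR l h ih =>
    simp only [BT.graft]
    split
    · exact Rot.congR _ h
    · exact Rot.congR _ (ih _)

lemma RotSeq.graft (S : BT) {n : ℕ} {t u : BT} (h : RotSeq n t u) (k : ℕ) :
    RotSeq n (graft S t k) (graft S u k) := by
  induction h with
  | refl t => exact RotSeq.refl _
  | step h _ ih => exact RotSeq.step (h.graft S k) ih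

lemma OccursAt.leavesBefore_lt {S T : BT} {p : List Bool} (h : OccursAt S T p) :
    leavesBefore T p < numLeaves (replaceAt T p leaf) := by
  induction h <;> simp only [numLeaves, leavesBefore, replaceAt] <;> omega

lemma OccursAt.graft_replaceAt {S T : BT} {p : List Bool} (h : OccursAt S T p) :
    graft S (replaceAt T p leaf) (leavesBefore T p) = T := by
  induction h with
  | here T => simp [replaceAt, graft]
  | left r h ih => simp [replaceAt, leavesBefore, graft, h.leavesBefore_lt, ih]
  | right l h ih => simp [replaceAt, leavesBefore, graft, ih]

/-- Join two possibly empty trees under a common root, suppressing the root when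
one of them is empty. -/
def join : Option BT → Option BT → Option BT
  | none, y => y
  | some x, none => some x
  | some x, some y => some (node x y)

/-- The tree induced by the leaves whose position satisfies `f`; it is `none`
when there is no such leaf. -/
def prune : BT → (ℕ → Bool) → Option BT
  | leaf, f => if f 0 then some leaf else none
  | node l r, f => join (prune l f) (prune r fun i => f (numLeaves l + i))

lemma prune_eq_some_self {t : BT} {f : ℕ → Bool} (hf : ∀ i < numLeaves t, f i = true) :
    prune t f = some t := by
  induction t generalizing f with
  | leaf => simp [prune, hf 0 (by simp [numLeaves])]
  | node l r ihl ihr =>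
    simp only [numLeaves] at hf
    rw [prune, ihl fun i hi => hf i (by omega), ihr fun i hi => hf _ (by omega), join]

lemma prune_eq_none {t : BT} {f : ℕ → Bool} (hf : ∀ i < numLeaves t, f i = false) :
    prune t f = none := by
  induction t generalizing f with
  | leaf => simp [prune, hf 0 (by simp [numLeaves])]
  | node l r ihl ihr =>
    simp only [numLeaves] at hf
    rw [prune, ihl fun i hi => hf i (by omega), ihr fun i hi => hf _ (by omega), join]

lemma prune_eq_some_leaf {t : BT} {f : ℕ → Bool} (h0 : f 0 = true)
    (hf : ∀ i < numLeaves t, 0 < i → f i = false) : prune t f = some leaf := by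
  induction t with
  | leaf => simp [prune, h0]
  | node l r ihl _ =>
    simp only [numLeaves] at hf
    have hl := numLeaves_pos l
    rw [prune, ihl fun i hi => hf i (by omega),
      prune_eq_none fun i hi => hf _ (by omega) (by omega), join]

lemma OccursAt.prune_eq {S T : BT} {p : List Bool} (h : OccursAt S T p) {f : ℕ → Bool}
    (hf : ∀ i < numLeaves T, f i = true ↔
      i ≤ leavesBefore T p ∨ leavesBefore T p + numLeaves S ≤ i) :
    prune T f = some (replaceAt T p leaf) := by
  induction h generalizing f with
  | here T =>
    simp only [leavesBefore] at hf
    rw [replaceAt]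
    refine prune_eq_some_leaf ((hf 0 (numLeaves_pos T)).2 (by omega)) fun i hi h0 => ?_
    rw [← Bool.not_eq_true, hf i hi]
    omega
  | left r h ih =>
    have hle := h.leavesBefore_add_le
    simp only [leavesBefore, numLeaves] at hf
    rw [prune, ih fun i hi => hf i (by omega),
      prune_eq_some_self fun i hi => (hf _ (by omega)).2 (by omega), join, replaceAt]
  | right l h ih =>
    simp only [leavesBefore, numLeaves] at hf
    rw [prune, ih fun i hi => (hf _ (by omega)).trans (by omega),
      prune_eq_some_self fun i hi => (hf i (by omega)).2 (by omega), join, replaceAt]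

/-- The possibly empty trees `x` and `y` are equal or differ by one rotation. -/
def RotOrEq (x y : Option BT) : Prop :=
  x = y ∨ ∃ t u, x = some t ∧ y = some u ∧ Rot t u

lemma Rot.prune {t u : BT} (h : Rot t u) (f : ℕ → Bool) :
    RotOrEq (prune t f) (prune u f) := by
  induction h generalizing f with
  | rotR a b c =>
    simp only [BT.prune, numLeaves, Nat.add_assoc]
    rcases BT.prune a f with _ | x <;>
    rcases BT.prune b (fun i => f (numLeaves a + i)) with _ | y <;>
    rcases BT.prune c (fun i => f (numLeaves a + (numLeaves b + i))) with _ | z <;>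
    first
    | exact Or.inl rfl
    | exact Or.inr ⟨_, _, rfl, rfl, Rot.rotR _ _ _⟩
  | rotL a b c =>
    simp only [BT.prune, numLeaves, Nat.add_assoc]
    rcases BT.prune a f with _ | x <;>
    rcases BT.prune b (fun i => f (numLeaves a + i)) with _ | y <;>
    rcases BT.prune c (fun i => f (numLeaves a + (numLeaves b + i))) with _ | z <;>
    first
    | exact Or.inl rfl
    | exact Or.inr ⟨_, _, rfl, rfl, Rot.rotL _ _ _⟩
  | congL r h ih =>
    simp only [BT.prune, h.numLeaves_eq]
    rcases ih f with h' | ⟨t, u, ht, hu, h'⟩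
    · exact Or.inl (by rw [h'])
    · rw [ht, hu]
      rcases BT.prune r _ with _ | z
      · exact Or.inr ⟨_, _, rfl, rfl, h'⟩
      · exact Or.inr ⟨_, _, rfl, rfl, Rot.congL _ h'⟩
  | congR l h ih =>
    simp only [BT.prune]
    rcases ih fun i => f (numLeaves l + i) with h' | ⟨t, u, ht, hu, h'⟩
    · exact Or.inl (by rw [h'])
    · rw [ht, hu]
      rcases BT.prune l _ with _ | z
      · exact Or.inr ⟨_, _, rfl, rfl, h'⟩
      · exact Or.inr ⟨_, _, rfl, rfl, Rot.congR _ h'⟩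

lemma RotSeq.exists_le_of_prune {n : ℕ} {t u : BT} (h : RotSeq n t u) {f : ℕ → Bool}
    {t' u' : BT} (ht : prune t f = some t') (hu : prune u f = some u') :
    ∃ m ≤ n, RotSeq m t' u' := by
  induction h generalizing t' with
  | refl t =>
    obtain rfl : t' = u' := Option.some.inj (ht.symm.trans hu)
    exact ⟨0, le_rfl, RotSeq.refl _⟩
  | step h _ ih =>
    rcases h.prune f with h' | ⟨v, w, hv, hw, h'⟩
    · obtain ⟨m, hm, hs⟩ := ih (h' ▸ ht) hu
      exact ⟨m, by omega, hs⟩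
    · obtain rfl : t' = v := Option.some.inj (ht.symm.trans hv)
      obtain ⟨m, hm, hs⟩ := ih hw hu
      exact ⟨m + 1, by omega, RotSeq.step h' hs⟩

/-- Pointwise domination of the lengths of rotation sequences compares rotation
distances; existence of a sequence for `t`, `u` is needed because `sInf ∅ = 0`. -/
lemma rotDist_le_rotDist {t u t' u' : BT} (hne : ∃ n, RotSeq n t u)
    (h : ∀ n, RotSeq n t u → ∃ m ≤ n, RotSeq m t' u') :
    rotDist t' u' ≤ rotDist t u := by
  obtain ⟨m, hm, hs⟩ := h _ (Nat.sInf_mem (s := {n | RotSeq n t u}) hne)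
  exact (Nat.sInf_le hs).trans hm

lemma rotDist_eq_rotDist {t u t' u' : BT}
    (h : ∀ n, RotSeq n t u → ∃ m ≤ n, RotSeq m t' u')
    (h' : ∀ n, RotSeq n t' u' → ∃ m ≤ n, RotSeq m t u) :
    rotDist t u = rotDist t' u' := by
  by_cases hne : ∃ n, RotSeq n t u
  · obtain ⟨n, hn⟩ := hne
    obtain ⟨m, -, hm⟩ := h n hn
    exact le_antisymm (rotDist_le_rotDist ⟨m, hm⟩ h') (rotDist_le_rotDist ⟨n, hn⟩ h)
  · have hne' : ¬ ∃ n, RotSeq n t' u' := fun ⟨n, hn⟩ =>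
      hne ((h' n hn).imp fun _ hm => hm.2)
    push Not at hne hne'
    simp [rotDist, hne, hne']

/-- The subtree reduction rule preserves rotation distance:
if `S` occurs as a subtree of both `T₁` and `T₂`, spanning the same interval
of leaf positions, then replacing `S` by a single new leaf in both trees does
not change the rotation distance. -/
theorem subtree_reduction_preserves_rotation_distance
    (T₁ T₂ S : BT) (p₁ p₂ : List Bool)
    (hleaves : T₁.numLeaves = T₂.numLeaves)
    (h₁ : OccursAt S T₁ p₁) (h₂ : OccursAt S T₂ p₂)
    (hpos : leavesBefore T₁ p₁ = leavesBefore T₂ p₂) :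
    rotDist (replaceAt T₁ p₁ leaf) (replaceAt T₂ p₂ leaf) = rotDist T₁ T₂ := by
  refine rotDist_eq_rotDist (fun n h => ⟨n, le_rfl, ?_⟩) fun n h => ?_
  · have h' := h.graft S (leavesBefore T₁ p₁)
    rwa [h₁.graft_replaceAt, hpos, h₂.graft_replaceAt] at h'
  · refine h.exists_le_of_prune
      (f := fun i => decide (i ≤ leavesBefore T₁ p₁ ∨ leavesBefore T₁ p₁ + numLeaves S ≤ i))
      (h₁.prune_eq fun i _ => by simp) (h₂.prune_eq fun i _ => by simp [hpos])

end BT
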